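/- arXiv:2503.17981 — 3 statements merged into one kernel-verified Lean document; each statement's English description precedes it below -/
import Mathlib

section
/- For every τ₀ ∈ (0,1) there exists a constant C = C(τ₀) > 0 such that for all τ ∈ (0, τ₀) and all x ∈ ℝ, |F_τ(x)| ≤ C(1 + |x|³). -/
/-- The flow `Φ_t(x) = x / √(x² + (1 − x²)·exp(−2t))` of the ODE `x' = x − x³`. -/
noncomputable def Phi (t x : ℝ) : ℝ :=
  x / Real.sqrt (x ^ 2 + (1 - x ^ 2) * Real.exp (-2 * t))

/-- `F_τ(x) = (Φ_τ(x) − x)/τ`. -/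
noncomputable def Ftau (τ x : ℝ) : ℝ := (Phi τ x - x) / τ

/-- `|F_τ(x)| ≤ C(1 + |x|³)` uniformly for `τ ∈ (0, τ₀)`. -/
theorem Ftau_growth (τ₀ : ℝ) (hτ₀ : τ₀ ∈ Set.Ioo (0 : ℝ) 1) :
    ∃ C : ℝ, 0 < C ∧ ∀ τ ∈ Set.Ioo (0 : ℝ) τ₀, ∀ x : ℝ,
      |Ftau τ x| ≤ C * (1 + |x| ^ 3) := by
  refine ⟨4 * Real.exp 1, by positivity, ?_⟩
  rintro τ ⟨hτ, hττ₀⟩ x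
  have hτ1 : τ < 1 := hττ₀.trans hτ₀.2
  unfold Ftau Phi
  set e := Real.exp (-2 * τ) with he
  set D := x ^ 2 + (1 - x ^ 2) * e with hD
  set r := Real.sqrt D with hr
  have he_le : e ≤ 1 := Real.exp_le_one_iff.2 (by linarith)
  have he_lower : 1 - e ≤ 2 * τ := by linarith [Real.add_one_le_exp (-2 * τ)]
  have hD_lower : Real.exp (-1) ^ 2 ≤ D := by
    have h : Real.exp (-1) ^ 2 ≤ e := by
      rw [← Real.exp_nat_mul, he, Real.exp_le_exp]
      push_cast
      linarith
    nlinarith [mul_nonneg (sq_nonneg x) (sub_nonneg.2 he_le)]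
  have hr_lower : Real.exp (-1) ≤ r := Real.le_sqrt_of_sq_le hD_lower
  have hr_pos : 0 < r := (Real.exp_pos _).trans_le hr_lower
  have hr_sq : r ^ 2 = D := Real.sq_sqrt ((sq_nonneg _).trans hD_lower)
  have hr_inv : 1 ≤ Real.exp 1 * r := by
    calc 1 = Real.exp 1 * Real.exp (-1) := by rw [← Real.exp_add]; simp
      _ ≤ _ := by gcongr
  have h_one_sub : |1 - r| ≤ (1 + |x| ^ 2) * (2 * τ) := by
    calc |1 - r| ≤ |1 - r| * (1 + r) := le_mul_of_one_le_right (abs_nonneg _) (by linarith)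
      _ = |(1 - x ^ 2) * (1 - e)| := by
        rw [← abs_of_pos (by linarith : 0 < 1 + r), ← abs_mul]
        congr 1
        linear_combination -hr_sq
      _ = |1 - x ^ 2| * (1 - e) := by rw [abs_mul, abs_of_nonneg (sub_nonneg.2 he_le)]
      _ ≤ (1 + |x| ^ 2) * (2 * τ) := by
        gcongr
        rw [sq_abs]
        exact abs_le.2 ⟨by linarith [sq_nonneg x], by linarith [sq_nonneg x]⟩
  have h_cubic : |x| * (1 + |x| ^ 2) ≤ 2 * (1 + |x| ^ 3) := by
    nlinarith [abs_nonneg x, mul_nonneg (abs_nonneg x) (sq_nonneg (|x| - 1)), sq_nonneg (|x| - 1)]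
  have h_eq : (x / r - x) / τ = x * (1 - r) / (r * τ) := by field_simp
  rw [h_eq, abs_div, abs_mul, abs_of_pos (mul_pos hr_pos hτ), div_le_iff₀ (mul_pos hr_pos hτ)]
  calc |x| * |1 - r| ≤ |x| * ((1 + |x| ^ 2) * (2 * τ)) := by gcongr
    _ = |x| * (1 + |x| ^ 2) * (2 * τ) := by ring
    _ ≤ 2 * (1 + |x| ^ 3) * (2 * τ) := by gcongr
    _ = 4 * (1 + |x| ^ 3) * τ * 1 := by ring
    _ ≤ 4 * (1 + |x| ^ 3) * τ * (Real.exp 1 * r) := by gcongr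
    _ = 4 * Real.exp 1 * (1 + |x| ^ 3) * (r * τ) := by ring
end

section
/- For every τ₀ ∈ (0,1) there exists a constant C = C(τ₀) > 0 such that for all τ ∈ (0, τ₀) and all x ∈ ℝ, the derivative of F_τ satisfies the one-sided bound F_τ'(x) ≤ exp(C·τ₀). -/
theorem exp_neg_two_mul (t : ℝ) : Real.exp (-2 * t) = Real.exp (-t) ^ 2 := by
  rw [← Real.exp_nat_mul]
  congr 1
  push_cast
  ring

theorem exp_neg_le_radicand {t : ℝ} (ht : 0 ≤ t) (x : ℝ) :
    Real.exp (-t) ^ 2 ≤ x ^ 2 + (1 - x ^ 2) * Real.exp (-2 * t) := by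
  have he := exp_neg_two_mul t
  have h1 : Real.exp (-2 * t) ≤ 1 := Real.exp_le_one_iff.mpr (by linarith)
  nlinarith [mul_nonneg (sq_nonneg x) (sub_nonneg.mpr h1)]

theorem hasDerivAt_Phi {t : ℝ} (ht : 0 ≤ t) (x : ℝ) :
    HasDerivAt (Phi t)
      (Real.exp (-t) ^ 2 / Real.sqrt (x ^ 2 + (1 - x ^ 2) * Real.exp (-2 * t)) ^ 3) x := by
  have he := exp_neg_two_mul t
  have hD : 0 < x ^ 2 + (1 - x ^ 2) * Real.exp (-2 * t) :=
    lt_of_lt_of_le (by positivity) (exp_neg_le_radicand ht x)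
  have hx2 : HasDerivAt (fun y : ℝ => y ^ 2) (2 * x) x := by
    simpa using hasDerivAt_pow 2 x
  have hrad := (hx2.add ((hx2.const_sub 1).mul_const (Real.exp (-2 * t)))).sqrt hD.ne'
  have hr : 0 < Real.sqrt (x ^ 2 + (1 - x ^ 2) * Real.exp (-2 * t)) := Real.sqrt_pos.mpr hD
  refine ((hasDerivAt_id x).div hrad hr.ne').congr_deriv ?_
  have hsq := Real.sq_sqrt hD.le
  simp only [id, Pi.add_apply]
  rw [← he]
  generalize Real.sqrt (x ^ 2 + (1 - x ^ 2) * Real.exp (-2 * t)) = r at hr hsq ⊢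
  generalize Real.exp (-2 * t) = e at hsq ⊢
  field_simp
  linear_combination hsq

theorem deriv_Phi_le {t : ℝ} (ht : 0 ≤ t) (x : ℝ) : deriv (Phi t) x ≤ Real.exp t := by
  rw [(hasDerivAt_Phi ht x).deriv]
  have hs : Real.exp (-t) ≤ Real.sqrt (x ^ 2 + (1 - x ^ 2) * Real.exp (-2 * t)) :=
    Real.le_sqrt_of_sq_le (exp_neg_le_radicand ht x)
  calc _ ≤ Real.exp (-t) ^ 2 / Real.exp (-t) ^ 3 := by gcongr
    _ = (Real.exp (-t))⁻¹ := by field_simp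
    _ = Real.exp t := by rw [Real.exp_neg, inv_inv]

/-- One-sided bound `F_τ'(x) ≤ exp(C·τ₀)` uniformly for `τ ∈ (0, τ₀)`. -/
theorem Ftau_deriv_one_sided (τ₀ : ℝ) (hτ₀ : τ₀ ∈ Set.Ioo (0 : ℝ) 1) :
    ∃ C : ℝ, 0 < C ∧ ∀ τ ∈ Set.Ioo (0 : ℝ) τ₀, ∀ x : ℝ,
      deriv (fun y => Ftau τ y) x ≤ Real.exp (C * τ₀) := by
  refine ⟨1, one_pos, fun τ hτ x => ?_⟩
  obtain ⟨hτ_pos, hτ_lt⟩ := hτ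
  have hderiv : deriv (fun y => Ftau τ y) x = (deriv (Phi τ) x - 1) / τ := by
    have hΦ := (hasDerivAt_Phi hτ_pos.le x).differentiableAt.hasDerivAt
    exact ((hΦ.sub (hasDerivAt_id x)).div_const τ).deriv
  have hexp : Real.exp τ - 1 ≤ Real.exp τ * τ := by
    have h := mul_le_mul_of_nonneg_left (Real.one_sub_le_exp_neg τ) (Real.exp_pos τ).le
    rw [← Real.exp_add, add_neg_cancel, Real.exp_zero] at h
    linarith
  rw [hderiv, one_mul, div_le_iff₀ hτ_pos]
  calc deriv (Phi τ) x - 1 ≤ Real.exp τ - 1 := by gcongr; exact deriv_Phi_le hτ_pos.le x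
    _ ≤ Real.exp τ * τ := hexp
    _ ≤ Real.exp τ₀ * τ := by gcongr
end

section
/- For every τ₀ ∈ (0,1) there exists a constant C = C(τ₀) > 0 such that for all τ ∈ (0, τ₀) and all x ∈ ℝ, |F_τ(x) − (x − x³)| ≤ C·τ·(1 + |x|⁵). -/
/-- Second-order expansion of `y ↦ 1 / √y` at `y = 1`, written in terms of `w = √y`. -/
theorem abs_inv_sub_one_add_le {w : ℝ} (hw : 1 / 3 ≤ w) :
    |w⁻¹ - 1 + (w ^ 2 - 1) / 2| ≤ 3 * (w ^ 2 - 1) ^ 2 := by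
  have hw0 : 0 < w := by linarith
  have h : w⁻¹ - 1 + (w ^ 2 - 1) / 2 = (w - 1) ^ 2 * (w + 2) / (2 * w) := by
    field_simp
    ring
  rw [h, abs_of_nonneg (by positivity), div_le_iff₀ (by positivity)]
  have h2 : w + 2 ≤ 3 * (w + 1) ^ 2 * (2 * w) := by nlinarith [mul_pos hw0 hw0, pow_pos hw0 3]
  calc (w - 1) ^ 2 * (w + 2) ≤ (w - 1) ^ 2 * (3 * (w + 1) ^ 2 * (2 * w)) := by gcongr
    _ = 3 * (w ^ 2 - 1) ^ 2 * (2 * w) := by ring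

theorem one_sub_exp_neg_two_mul_le (τ : ℝ) : 1 - Real.exp (-2 * τ) ≤ 2 * τ := by
  linarith [Real.add_one_le_exp (-2 * τ)]

theorem le_one_sub_exp_neg_two_mul {τ : ℝ} (hτ : 0 ≤ τ) :
    2 * τ - 4 * τ ^ 2 ≤ 1 - Real.exp (-2 * τ) := by
  have h1 := Real.add_one_le_exp (2 * τ)
  have h2 : Real.exp (-2 * τ) * Real.exp (2 * τ) = 1 := by
    rw [← Real.exp_add]
    simp
  have h3 := Real.exp_pos (-2 * τ)
  have h4 : Real.exp (-2 * τ) * (2 * τ + 1) ≤ 1 :=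
    (mul_le_mul_of_nonneg_left h1 h3.le).trans_eq h2
  nlinarith [pow_nonneg hτ 3]

theorem one_ninth_le_exp_neg_two_mul {τ : ℝ} (hτ : τ ≤ 1) : 1 / 9 ≤ Real.exp (-2 * τ) := by
  have h1 : Real.exp (-2) ≤ Real.exp (-2 * τ) := Real.exp_le_exp.2 (by linarith)
  have h2 : Real.exp (-2) * (Real.exp 1 * Real.exp 1) = 1 := by
    rw [← Real.exp_add, ← Real.exp_add]
    norm_num
  have h3 : Real.exp 1 * Real.exp 1 ≤ 3 * 3 := by
    have := Real.exp_one_lt_three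
    gcongr
  nlinarith [Real.exp_pos (-2)]

theorem abs_Phi_sub_le {τ : ℝ} (h0 : 0 ≤ τ) (h1 : τ ≤ 1) (x : ℝ) :
    |Phi τ x - x - τ * (x - x ^ 3)| ≤ 28 * τ ^ 2 * (1 + |x| ^ 5) := by
  have hs_le := one_sub_exp_neg_two_mul_le τ
  have hle_s := le_one_sub_exp_neg_two_mul h0
  have hexp := one_ninth_le_exp_neg_two_mul h1
  have hexp1 : Real.exp (-2 * τ) ≤ 1 := Real.exp_le_one_iff.2 (by linarith)
  unfold Phi
  set q := Real.exp (-2 * τ)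
  have hD : (1 / 3 : ℝ) ^ 2 ≤ x ^ 2 + (1 - x ^ 2) * q := by nlinarith [sq_nonneg x]
  set w := Real.sqrt (x ^ 2 + (1 - x ^ 2) * q) with hw
  have hw3 : 1 / 3 ≤ w := Real.le_sqrt_of_sq_le hD
  have hw2 : w ^ 2 = x ^ 2 + (1 - x ^ 2) * q := Real.sq_sqrt (by linarith)
  have hu : w ^ 2 - 1 = (x ^ 2 - 1) * (1 - q) := by rw [hw2]; ring
  have hR := abs_inv_sub_one_add_le hw3
  have hsq : (1 - q) ^ 2 ≤ 4 * τ ^ 2 := by nlinarith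
  have hR' : |w⁻¹ - 1 + (w ^ 2 - 1) / 2| ≤ 12 * τ ^ 2 * (|x| ^ 4 + 1) := by
    calc _ ≤ 3 * (w ^ 2 - 1) ^ 2 := hR
      _ = 3 * ((x ^ 2 - 1) ^ 2 * (1 - q) ^ 2) := by rw [hu]; ring
      _ ≤ 3 * ((x ^ 4 + 1) * (4 * τ ^ 2)) := by
        gcongr
        nlinarith [sq_nonneg x]
      _ = 12 * τ ^ 2 * (|x| ^ 4 + 1) := by
        rw [Even.pow_abs (by decide)]
        ring
  have hS : |(1 - q) / 2 - τ| ≤ 2 * τ ^ 2 := abs_le.2 ⟨by linarith, by nlinarith⟩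
  have hx : |1 - x ^ 2| ≤ 1 + |x| ^ 2 := by
    rw [sq_abs]
    exact abs_le.2 ⟨by nlinarith [sq_nonneg x], by nlinarith [sq_nonneg x]⟩
  have key : x / w - x - τ * (x - x ^ 3)
      = x * (w⁻¹ - 1 + (w ^ 2 - 1) / 2) + x * (1 - x ^ 2) * ((1 - q) / 2 - τ) := by
    rw [hu]
    ring
  have ha := abs_nonneg x
  have hpow1 : |x| ≤ 1 + |x| ^ 5 := by
    rcases le_total |x| 1 with h | h
    · linarith [pow_nonneg ha 5]
    · linarith [le_self_pow₀ h (show 5 ≠ 0 by norm_num)]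
  have hpow3 : |x| ^ 3 ≤ 1 + |x| ^ 5 := by
    rcases le_total |x| 1 with h | h
    · linarith [pow_nonneg ha 5, pow_le_one₀ (n := 3) ha h]
    · linarith [pow_le_pow_right₀ h (show 3 ≤ 5 by norm_num)]
  rw [key]
  calc _ ≤ |x| * |w⁻¹ - 1 + (w ^ 2 - 1) / 2| + |x| * |1 - x ^ 2| * |(1 - q) / 2 - τ| := by
        rw [← abs_mul, ← abs_mul, ← abs_mul]
        exact abs_add_le _ _
    _ ≤ |x| * (12 * τ ^ 2 * (|x| ^ 4 + 1)) + |x| * (1 + |x| ^ 2) * (2 * τ ^ 2) := by gcongr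
    _ = τ ^ 2 * (12 * |x| ^ 5 + 14 * |x| + 2 * |x| ^ 3) := by ring
    _ ≤ τ ^ 2 * (28 * (1 + |x| ^ 5)) := by
        gcongr
        linarith
    _ = 28 * τ ^ 2 * (1 + |x| ^ 5) := by ring

/-- `|F_τ(x) − (x − x³)| ≤ C·τ·(1 + |x|⁵)` uniformly for `τ ∈ (0, τ₀)`. -/
theorem Ftau_approx_f (τ₀ : ℝ) (hτ₀ : τ₀ ∈ Set.Ioo (0 : ℝ) 1) :
    ∃ C : ℝ, 0 < C ∧ ∀ τ ∈ Set.Ioo (0 : ℝ) τ₀, ∀ x : ℝ,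
      |Ftau τ x - (x - x ^ 3)| ≤ C * τ * (1 + |x| ^ 5) := by
  refine ⟨28, by norm_num, fun τ hτ x => ?_⟩
  have hpos : 0 < τ := hτ.1
  have h := abs_Phi_sub_le hpos.le (hτ.2.trans hτ₀.2).le x
  have heq : Ftau τ x - (x - x ^ 3) = (Phi τ x - x - τ * (x - x ^ 3)) / τ := by
    unfold Ftau
    field_simp
  rw [heq, abs_div, abs_of_pos hpos, div_le_iff₀ hpos]
  linarith
end
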